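/- For each integer N ≥ 1, let b_N be the number of quadruples (m, n, p, q) of integers with m ≥ n ≥ 1, p ≥ 0, q ≥ 0, with (m > n or p ≤ q), with m + n + p + q = N − 1, and such that the convolution sequence (r_i)_{i≥1} associated to (m, n, p, q) is not unimodal. Then b_N = 0 for 1 ≤ N ≤ 9, and for every integer k ≥ 0: b_{2k+10} = 2·∑_{i=0}^{k} ⌊i(i+4)/4⌋ − ⌊k²/4⌋ and b_{2k+11} = 2·∑_{i=0}^{k} ⌊i(i+4)/4⌋ + ⌊(k+1)(k+5)/4⌋ − ⌊k²/4⌋. -/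

import Mathlib

/-- The sequence of `p` ones followed by the binomial coefficients
`choose m 0, …, choose m m` and then zeros (indexed from 1; the value at 0 is 0). -/
def broomSeq (m p : ℕ) : ℕ → ℕ := fun i =>
  if 1 ≤ i ∧ i ≤ p then 1
  else if p + 1 ≤ i ∧ i ≤ p + m + 1 then Nat.choose m (i - p - 1)
  else 0

/-- The convolution `r_i = ∑_{j=1}^{i} s_j * t_{i+1-j}` of the two broom sequences. -/
def convSeq (m n p q : ℕ) : ℕ → ℕ := fun i =>
  ∑ j ∈ Finset.Icc 1 i, broomSeq m p j * broomSeq n q (i + 1 - j)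

/-- A sequence (indexed from 1) is unimodal if for some `k ≥ 1` it is
nondecreasing up to `k` and nonincreasing from `k` on. -/
def Unimodal (a : ℕ → ℕ) : Prop :=
  ∃ k : ℕ, 1 ≤ k ∧ (∀ i, 1 ≤ i → i < k → a i ≤ a (i + 1)) ∧ (∀ i, k ≤ i → a (i + 1) ≤ a i)

/-- The number of trees on `N` vertices that are merges of two brooms whose subtree poset
rank sequence (the convolution sequence) is not unimodal, where the quadruple
`(m, n, p, q)` is normalized by `m ≥ n ≥ 1`, and `p ≤ q` when `m = n`. -/
noncomputable def bCount (N : ℕ) : ℕ :=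
  Set.ncard {x : ℕ × ℕ × ℕ × ℕ |
    1 ≤ x.2.1 ∧ x.2.1 ≤ x.1 ∧ (x.2.1 < x.1 ∨ x.2.2.1 ≤ x.2.2.2) ∧
    x.1 + x.2.1 + x.2.2.1 + x.2.2.2 = N - 1 ∧
    ¬ Unimodal (convSeq x.1 x.2.1 x.2.2.1 x.2.2.2)}

/-- The coefficients of `(1 - X) * (1 + X) ^ N`. -/
def chooseDiff (N l : ℕ) : ℤ := N.choose l - if l = 0 then 0 else (N.choose (l - 1) : ℤ)

theorem broomSeq_succ (m p i : ℕ) :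
    broomSeq m p (i + 1) = if i < p then 1 else m.choose (i - p) := by
  unfold broomSeq
  by_cases h : i < p
  · rw [if_pos (by omega), if_pos h]
  · rw [if_neg (by omega), if_neg h]
    split_ifs with h'
    · congr 1; omega
    · rw [Nat.choose_eq_zero_of_lt (by omega)]

theorem convSeq_succ (m n p q i : ℕ) :
    convSeq m n p q (i + 1) = ∑ x ∈ Finset.HasAntidiagonal.antidiagonal i,
      broomSeq m p (x.1 + 1) * broomSeq n q (x.2 + 1) := by
  unfold convSeq
  rw [Finset.Nat.sum_antidiagonal_eq_sum_range_succ
    (fun a b => broomSeq m p (a + 1) * broomSeq n q (b + 1)), Finset.range_eq_Ico,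
    ← Finset.Ico_add_one_right_eq_Icc, Finset.sum_Ico_eq_sum_range, ← Finset.range_eq_Ico]
  refine Finset.sum_congr rfl fun j hj => ?_
  rw [Finset.mem_range] at hj
  rw [add_comm 1 j, show i + 1 + 1 - (j + 1) = i - j + 1 by omega]

namespace PowerSeries

theorem coeff_one_add_X_pow (m i : ℕ) : coeff i ((1 + X : ℤ⟦X⟧) ^ m) = m.choose i := by
  have h : ((1 + X : ℤ⟦X⟧) ^ m) = (((1 + Polynomial.X) ^ m : Polynomial ℤ) : ℤ⟦X⟧) := by simp
  rw [h, Polynomial.coeff_coe, Polynomial.coeff_one_add_X_pow]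

theorem coeff_one_sub_X_mul (f : ℤ⟦X⟧) (i : ℕ) :
    coeff i ((1 - X) * f) = coeff i f - if i = 0 then 0 else coeff (i - 1) f := by
  rw [sub_mul, one_mul, map_sub]
  cases i <;> simp [coeff_succ_X_mul]

/-- The generating function of a broom sequence. -/
noncomputable def broom (m p : ℕ) : ℤ⟦X⟧ := mk fun i => (broomSeq m p (i + 1) : ℤ)

theorem broom_eq (m p : ℕ) :
    broom m p = ∑ i ∈ Finset.range p, X ^ i + X ^ p * (1 + X) ^ m := by
  ext i
  simp only [broom, coeff_mk, broomSeq_succ, map_add, map_sum, coeff_X_pow, coeff_X_pow_mul',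
    coeff_one_add_X_pow, Finset.sum_ite_eq, Finset.mem_range]
  by_cases h : i < p
  · simp [h]
  · simp [h, not_lt.mp h]

theorem one_sub_X_mul_broom (m p : ℕ) :
    (1 - X) * broom m p = 1 - X ^ p + X ^ p * ((1 - X) * (1 + X) ^ m) := by
  rw [broom_eq, mul_add, mul_neg_geom_sum]
  ring

theorem coeff_broom_mul_broom (m n p q i : ℕ) :
    coeff i (broom m p * broom n q) = (convSeq m n p q (i + 1) : ℤ) := by
  simp [coeff_mul, convSeq_succ, broom]

end PowerSeries

open PowerSeries in
theorem convSeq_succ_sub (m n p q i : ℕ) :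
    (convSeq m n p q (i + 1) : ℤ) - convSeq m n p q i =
      (broomSeq n q (i + 1) +
        if p ≤ i then (m.choose (i - p) : ℤ) - broomSeq n q (i - p + 1) else 0) +
        if p + q ≤ i then chooseDiff (m + n) (i - (p + q)) - m.choose (i - (p + q)) else 0 := by
  have key : (1 - X) * (broom m p * broom n q) =
      broom n q + X ^ p * ((1 + X) ^ m - broom n q) +
        X ^ (p + q) * ((1 - X) * (1 + X) ^ (m + n) - (1 + X) ^ m) := by
    linear_combination broom n q * one_sub_X_mul_broom m p +
      X ^ p * (1 + X) ^ m * one_sub_X_mul_broom n q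
  have h := congrArg (coeff i) key
  rw [coeff_one_sub_X_mul] at h
  simp only [map_add, coeff_X_pow_mul', map_sub, coeff_one_add_X_pow, coeff_one_sub_X_mul,
    coeff_broom_mul_broom] at h
  have e (j : ℕ) : coeff j (broom n q) = (broomSeq n q (j + 1) : ℤ) := by simp [broom]
  rw [e, e] at h
  rw [chooseDiff, ← h]
  congr 1
  cases i <;> simp [convSeq]

theorem convSeq_succ_sub_of_lt {m n p q i : ℕ} (h : i < p + q) :
    (convSeq m n p q (i + 1) : ℤ) - convSeq m n p q i =
      (if i < q then 1 else (n.choose (i - q) : ℤ)) +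
        if i < p then 0 else (m.choose (i - p) : ℤ) - 1 := by
  rw [convSeq_succ_sub, if_neg (c := p + q ≤ i) (by omega), broomSeq_succ, broomSeq_succ, add_zero]
  congr 1
  · split_ifs <;> simp
  · by_cases hp : i < p
    · rw [if_neg (by omega), if_pos hp]
    · rw [if_pos (by omega), if_neg hp, if_pos (by omega)]
      simp

theorem convSeq_succ_sub_add (m n p q l : ℕ) :
    (convSeq m n p q (p + q + l + 1) : ℤ) - convSeq m n p q (p + q + l) =
      chooseDiff (m + n) l - m.choose l - n.choose l + m.choose (q + l) + n.choose (p + l) := by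
  rw [convSeq_succ_sub, if_pos (by omega), if_pos (by omega), broomSeq_succ, broomSeq_succ,
    if_neg (by omega), if_neg (by omega), show p + q + l - q = p + l by omega,
    show p + q + l - p = q + l by omega, show q + l - q = l by omega,
    show p + q + l - (p + q) = l by omega]
  ring

theorem Int.choose_succ_mul (n k : ℕ) :
    (n.choose (k + 1) : ℤ) * (k + 1) = n.choose k * (n - k) := by
  rcases le_or_gt k n with h | h
  · have := Nat.choose_succ_right_eq n k
    zify [h] at this
    exact this
  · simp [Nat.choose_eq_zero_of_lt h, Nat.choose_eq_zero_of_lt (Nat.lt_succ_of_lt h)]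

theorem chooseDiff_zero (N : ℕ) : chooseDiff N 0 = 1 := by simp [chooseDiff]

theorem chooseDiff_succ (N l : ℕ) : chooseDiff N (l + 1) = N.choose (l + 1) - N.choose l := by
  simp [chooseDiff]

theorem chooseDiff_one (N : ℕ) : chooseDiff N 1 = N - 1 := by simp [chooseDiff]

theorem chooseDiff_succ_mul (N l : ℕ) :
    chooseDiff N (l + 1) * (l + 1) = N.choose l * (N - 2 * l - 1) := by
  rw [chooseDiff_succ]
  linear_combination Int.choose_succ_mul N l

theorem chooseDiff_mul {N l : ℕ} (hl : l ≠ 0) :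
    chooseDiff N l * (N - l + 1) = N.choose l * (N - 2 * l + 1) := by
  obtain ⟨k, rfl⟩ := Nat.exists_eq_succ_of_ne_zero hl
  rw [Nat.succ_eq_add_one, chooseDiff_succ]
  push_cast
  linear_combination Int.choose_succ_mul N k

theorem chooseDiff_ratio {N l : ℕ} (hl : l ≠ 0) :
    chooseDiff N (l + 1) * (l + 1) * (N - 2 * l + 1) =
      chooseDiff N l * (N - l + 1) * (N - 2 * l - 1) := by
  linear_combination (N - 2 * l + 1 : ℤ) * chooseDiff_succ_mul N l -
    (N - 2 * l - 1 : ℤ) * chooseDiff_mul (N := N) hl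

theorem chooseDiff_nonneg {N l : ℕ} (h : 2 * l ≤ N + 1) : 0 ≤ chooseDiff N l := by
  rcases eq_or_ne l 0 with rfl | hl
  · simp [chooseDiff_zero]
  · have h1 : (0 : ℤ) < N - l + 1 := by omega
    have h2 := chooseDiff_mul (N := N) hl
    have h3 : (0 : ℤ) ≤ N.choose l * (N - 2 * l + 1) := mul_nonneg (by positivity) (by omega)
    rw [← h2] at h3
    exact nonneg_of_mul_nonneg_left h3 h1

theorem chooseDiff_succ_nonpos {N l : ℕ} (h : N ≤ 2 * l + 1) : chooseDiff N (l + 1) ≤ 0 := by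
  have h1 := chooseDiff_succ_mul N l
  have h2 : (N.choose l : ℤ) * (N - 2 * l - 1) ≤ 0 :=
    mul_nonpos_of_nonneg_of_nonpos (by positivity) (by omega)
  rw [← h1] at h2
  exact nonpos_of_mul_nonpos_left h2 (by positivity)

theorem choose_add_le_choose {m l : ℕ} (h : m ≤ 2 * l + 1) (q : ℕ) :
    m.choose (q + l) ≤ m.choose l := by
  induction q with
  | zero => simp
  | succ q ih =>
    refine le_trans ?_ ih
    have h1 := Int.choose_succ_mul m (q + l)
    push_cast at h1
    have h2 : (m.choose (q + l) : ℤ) * (m - (q + l)) ≤ m.choose (q + l) * (q + l + 1) :=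
      mul_le_mul_of_nonneg_left (by omega) (by positivity)
    rw [← h1] at h2
    have h3 := le_of_mul_le_mul_right h2 (by positivity)
    rw [show q + 1 + l = q + l + 1 by omega]
    exact_mod_cast h3

theorem choose_add_choose_le_chooseDiff_succ {m n l : ℕ} (hn : 1 ≤ n) (hnm : n ≤ m) (hl : l ≠ 0)
    (h : 2 * n * l ≤ (n - 1) * (m + n + 1))
    (hle : (m.choose l + n.choose l : ℤ) ≤ chooseDiff (m + n) l) :
    (m.choose (l + 1) + n.choose (l + 1) : ℤ) ≤ chooseDiff (m + n) (l + 1) := by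
  have h : (2 * n * l : ℤ) ≤ (n - 1) * (m + n + 1) := by zify [hn] at h; exact h
  have hn' : (1 : ℤ) ≤ n := by exact_mod_cast hn
  have hnm' : (n : ℤ) ≤ m := by exact_mod_cast hnm
  have hpos : (0 : ℤ) < m + n - 2 * l + 1 := by nlinarith
  have hml : (0 : ℤ) ≤ m - l := by nlinarith
  have hD : 0 ≤ chooseDiff (m + n) l := le_trans (by positivity) hle
  have hr := chooseDiff_ratio (N := m + n) hl
  push_cast at hr
  have h1 : chooseDiff (m + n) l * (m - l) ≤ chooseDiff (m + n) (l + 1) * (l + 1) := by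
    refine le_of_mul_le_mul_right ?_ hpos
    rw [hr, mul_assoc, mul_assoc]
    exact mul_le_mul_of_nonneg_left (by nlinarith) hD
  have h2 : (m.choose l + n.choose l : ℤ) * (m - l) ≤ chooseDiff (m + n) l * (m - l) :=
    mul_le_mul_of_nonneg_right hle hml
  have h3 : (n.choose l : ℤ) * (n - l) ≤ n.choose l * (m - l) :=
    mul_le_mul_of_nonneg_left (by omega) (by positivity)
  refine le_of_mul_le_mul_right (a := (l + 1 : ℤ)) ?_ (by positivity)
  linarith [Int.choose_succ_mul m l, Int.choose_succ_mul n l]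

theorem chooseDiff_sub_choose_succ_nonpos {m n l : ℕ} (q : ℕ) (hn : 1 ≤ n) (hnm : n ≤ m)
    (hl : l ≠ 0) (h : (n - 1) * (m + n + 1) ≤ 2 * n * l)
    (hle : chooseDiff (m + n) l - m.choose l + m.choose (q + l) ≤ 0) :
    chooseDiff (m + n) (l + 1) - m.choose (l + 1) + m.choose (q + (l + 1)) ≤ 0 := by
  have h : ((n - 1) * (m + n + 1) : ℤ) ≤ 2 * n * l := by zify [hn] at h; exact h
  rcases le_or_gt (m + n + 1) (2 * l) with hN | hN
  · have h1 := chooseDiff_succ_nonpos (N := m + n) (l := l) (by omega)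
    have h2 := choose_add_le_choose (m := m) (l := l + 1) (by omega) q
    zify at h2
    linarith
  · have hpos : (0 : ℤ) < m + n - 2 * l + 1 := by omega
    have hml : (0 : ℤ) ≤ m - l := by omega
    have hD := chooseDiff_nonneg (N := m + n) (l := l) (by omega)
    have hr := chooseDiff_ratio (N := m + n) hl
    push_cast at hr
    have h1 : chooseDiff (m + n) (l + 1) * (l + 1) ≤ chooseDiff (m + n) l * (m - l) := by
      refine le_of_mul_le_mul_right ?_ hpos
      rw [hr, mul_assoc, mul_assoc]
      exact mul_le_mul_of_nonneg_left (by nlinarith) hD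
    have h2 : chooseDiff (m + n) l * (m - l) ≤ (m.choose l - m.choose (q + l)) * (m - l) :=
      mul_le_mul_of_nonneg_right (by linarith) hml
    have h3 := Int.choose_succ_mul m (q + l)
    have h4 : (0 : ℤ) ≤ m.choose (q + l) * q := by positivity
    have h5 : (0 : ℤ) ≤ m.choose (q + l + 1) * q := by positivity
    push_cast at h3
    have h6 : (m.choose (q + l + 1) : ℤ) * (l + 1) ≤ m.choose (q + l) * (m - l) := by linarith
    rw [← add_assoc]
    have h7 : chooseDiff (m + n) (l + 1) ≤ m.choose (l + 1) - m.choose (q + l + 1) := by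
      refine le_of_mul_le_mul_right (a := (l + 1 : ℤ)) ?_ (by positivity)
      linarith [Int.choose_succ_mul m l]
    linarith

theorem broomSeq_eq_zero {m p i : ℕ} (h : p + m + 1 < i) : broomSeq m p i = 0 := by
  unfold broomSeq
  rw [if_neg (by omega), if_neg (by omega)]

theorem convSeq_eq_zero {m n p q i : ℕ} (h : p + m + 1 + (q + n + 1) < i + 1) :
    convSeq m n p q i = 0 := by
  refine Finset.sum_eq_zero fun j _ => ?_
  rcases lt_or_ge (p + m + 1) j with hj | hj
  · rw [broomSeq_eq_zero hj, zero_mul]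
  · rw [broomSeq_eq_zero (i := i + 1 - j) (by omega), mul_zero]

theorem unimodal_of_le_imp_le {a : ℕ → ℕ} {K M : ℕ} (hK : ∀ i < K, a i ≤ a (i + 1))
    (hstep : ∀ i, K ≤ i → a (i + 1) ≤ a i → a (i + 2) ≤ a (i + 1))
    (hM : ∀ i, M < i → a i = 0) : Unimodal a := by
  have hex : ∃ i, K ≤ i ∧ a (i + 1) ≤ a i :=
    ⟨max K M, le_max_left _ _, by rw [hM _ (by omega)]; exact Nat.zero_le _⟩
  classical
  obtain ⟨hk1, hk2⟩ := Nat.find_spec hex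
  have hmin := fun i => Nat.find_min hex (m := i)
  generalize Nat.find hex = k at hk1 hk2 hmin
  have hdown : ∀ i, k ≤ i → a (i + 1) ≤ a i := by
    intro i hi
    induction i, hi using Nat.le_induction with
    | base => exact hk2
    | succ i hi ih => exact hstep i (by omega) ih
  refine ⟨max k 1, le_max_right _ _, fun i h1 h2 => ?_, fun i hi => hdown i (by omega)⟩
  by_cases h : i < K
  · exact hK i h
  · by_contra hlt
    exact hmin i (by omega) ⟨by omega, by omega⟩

theorem two_mul_choose_two (n : ℕ) : (n.choose 2 : ℤ) * 2 = n * (n - 1) := by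
  have := Int.choose_succ_mul n 1
  simp at this
  linarith

theorem chooseDiff_two_sub (m n : ℕ) :
    chooseDiff (m + n) 2 - m.choose 2 - n.choose 2 = m * n - m - n := by
  have h1 := two_mul_choose_two (m + n)
  have h2 := two_mul_choose_two m
  have h3 := two_mul_choose_two n
  rw [chooseDiff_succ, Nat.choose_one_right]
  push_cast at *
  linarith

theorem convSeq_le_succ_of_lt {m n p q i : ℕ} (h : i < p + q) (hi : i ≤ p + m ∨ i ≤ q + n) :
    convSeq m n p q i ≤ convSeq m n p q (i + 1) := by
  have hd := convSeq_succ_sub_of_lt (m := m) (n := n) h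
  have hpos : i < q ∨ i < p ∨ 0 < n.choose (i - q) ∨ 0 < m.choose (i - p) := by
    rcases hi with hi | hi
    · right; right; right; exact Nat.choose_pos (by omega)
    · right; right; left; exact Nat.choose_pos (by omega)
  split_ifs at hd <;> omega

theorem choose_add_choose_le_chooseDiff {m n l : ℕ} (hn : 2 ≤ n) (hnm : n ≤ m) (h2 : 2 ≤ l)
    (hl : l ≤ n ∨ l ≤ (n - 1) * (m + n + 1) / (2 * n)) :
    (m.choose l + n.choose l : ℤ) ≤ chooseDiff (m + n) l := by
  induction l, h2 using Nat.le_induction with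
  | base =>
    have := chooseDiff_two_sub m n
    zify at hn hnm
    nlinarith
  | succ l h2 ih =>
    refine choose_add_choose_le_chooseDiff_succ (by omega) hnm (by omega) ?_ (ih (by omega))
    rcases hl with hl | hl
    · obtain ⟨n, rfl⟩ := Nat.exists_eq_add_of_le' (show 1 ≤ n by omega)
      rw [Nat.add_sub_cancel]
      nlinarith
    · have := (Nat.le_div_iff_mul_le (by omega)).mp hl
      nlinarith

theorem unimodal_convSeq_of_lt {m n p q : ℕ} (hn : 1 ≤ n) (hnm : n ≤ m) (h : q < m ∨ p < n) :
    Unimodal (convSeq m n p q) := by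
  refine unimodal_of_le_imp_le (K := p + q + max (n + 1) ((n - 1) * (m + n + 1) / (2 * n) + 1))
    (M := p + m + 1 + (q + n + 1)) (fun i hi => ?_) (fun i hi => ?_)
    (fun i hi => convSeq_eq_zero (by omega))
  · rcases lt_or_ge i (p + q) with hpq | hpq
    · exact convSeq_le_succ_of_lt hpq (by omega)
    · obtain ⟨l, rfl⟩ := Nat.exists_eq_add_of_le hpq
      have hd := convSeq_succ_sub_add m n p q l
      have hl : l < 2 → 0 < m.choose (q + l) ∨ 0 < n.choose (p + l) := fun hl => by
        rcases h with h | h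
        · exact .inl (Nat.choose_pos (by omega))
        · exact .inr (Nat.choose_pos (by omega))
      rcases (by omega : l = 0 ∨ l = 1 ∨ 2 ≤ l) with rfl | rfl | h2
      · simp only [chooseDiff_zero, Nat.choose_zero_right] at hd
        omega
      · simp only [chooseDiff_one, Nat.choose_one_right] at hd
        omega
      · have hn2 : 2 ≤ n := by
          by_contra hn2
          obtain rfl : n = 1 := by omega
          simp at hi
          omega
        have := choose_add_choose_le_chooseDiff hn2 hnm h2 (by omega)
        omega
  · obtain ⟨l, rfl⟩ := Nat.exists_eq_add_of_le (show p + q ≤ i by omega)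
    have hd := convSeq_succ_sub_add m n p q l
    have hd' := convSeq_succ_sub_add m n p q (l + 1)
    have hl : (n - 1) * (m + n + 1) ≤ 2 * n * l := by
      have : (n - 1) * (m + n + 1) / (2 * n) < l := by omega
      have := (Nat.div_lt_iff_lt_mul (by omega)).mp this
      nlinarith
    have key := chooseDiff_sub_choose_succ_nonpos q hn hnm (l := l) (by omega) hl
    rw [Nat.choose_eq_zero_of_lt (n := n) (k := l) (by omega),
      Nat.choose_eq_zero_of_lt (n := n) (k := p + l) (by omega)] at hd
    rw [Nat.choose_eq_zero_of_lt (n := n) (k := l + 1) (by omega),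
      Nat.choose_eq_zero_of_lt (n := n) (k := p + (l + 1)) (by omega)] at hd'
    simp only [← add_assoc] at hd' key ⊢
    rw [show p + q + l + 2 = p + q + l + 1 + 1 by rfl]
    intro hle
    have := key (by omega)
    omega

theorem chooseDiff_le_choose_add_choose {m n l : ℕ} (hl : l ≠ 0)
    (h : n = 1 ∨ m = 2 ∧ n = 2) :
    chooseDiff (m + n) l ≤ m.choose l + n.choose l := by
  obtain ⟨l, rfl⟩ := Nat.exists_eq_succ_of_ne_zero hl
  rw [Nat.succ_eq_add_one, chooseDiff_succ]
  rcases h with rfl | ⟨rfl, rfl⟩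
  · rcases l with _ | l
    · simp
    · rw [Nat.choose_succ_succ m, Nat.choose_succ_succ m]
      push_cast
      linarith [Int.natCast_nonneg (m.choose l), Int.natCast_nonneg (Nat.choose 1 (l + 1 + 1))]
  · rcases (by omega : l = 0 ∨ l = 1 ∨ l = 2 ∨ l = 3 ∨ 4 ≤ l) with rfl | rfl | rfl | rfl | h
    iterate 4 simp [Nat.choose]
    rw [Nat.choose_eq_zero_of_lt (n := 2 + 2) (k := l + 1) (by omega)]
    push_cast
    linarith [Int.natCast_nonneg ((2 + 2).choose l), Int.natCast_nonneg (Nat.choose 2 (l + 1))]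

theorem unimodal_convSeq_of_le {m n p q : ℕ} (hp : n ≤ p) (hq : m ≤ q)
    (h : n = 1 ∨ m = 2 ∧ n = 2) : Unimodal (convSeq m n p q) := by
  have hdown : ∀ i, max (p + m) (q + n) < i → convSeq m n p q (i + 1) ≤ convSeq m n p q i := by
    intro i hi
    rcases lt_or_ge i (p + q) with hpq | hpq
    · have hd := convSeq_succ_sub_of_lt (m := m) (n := n) hpq
      rw [Nat.choose_eq_zero_of_lt (n := n) (k := i - q) (by omega),
        Nat.choose_eq_zero_of_lt (n := m) (k := i - p) (by omega)] at hd
      split_ifs at hd <;> omega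
    · obtain ⟨l, rfl⟩ := Nat.exists_eq_add_of_le hpq
      have hd := convSeq_succ_sub_add m n p q l
      rw [Nat.choose_eq_zero_of_lt (n := n) (k := p + l) (by omega),
        Nat.choose_eq_zero_of_lt (n := m) (k := q + l) (by omega)] at hd
      rcases eq_or_ne l 0 with rfl | hl
      · simp only [chooseDiff_zero, Nat.choose_zero_right] at hd
        omega
      · have := chooseDiff_le_choose_add_choose hl h
        omega
  refine unimodal_of_le_imp_le (K := min (max (p + m) (q + n) + 1) (p + q))
    (M := p + m + 1 + (q + n + 1)) (fun i hi => convSeq_le_succ_of_lt (by omega) (by omega))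
    (fun i hi hle => ?_) (fun i hi => convSeq_eq_zero (by omega))
  exact hdown (i + 1) (by omega)

theorem not_unimodal_convSeq {m n p q : ℕ} (hn : 2 ≤ n) (hm : 3 ≤ m) (hp : n ≤ p) (hq : m ≤ q) :
    ¬ Unimodal (convSeq m n p q) := by
  rintro ⟨k, -, hup, hdown⟩
  have h1 := convSeq_succ_sub_add m n p q 1
  have h2 := convSeq_succ_sub_add m n p q 2
  have h3 := chooseDiff_two_sub m n
  rw [Nat.choose_eq_zero_of_lt (n := n) (k := p + 1) (by omega),
    Nat.choose_eq_zero_of_lt (n := m) (k := q + 1) (by omega), chooseDiff_one,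
    Nat.choose_one_right, Nat.choose_one_right] at h1
  rw [Nat.choose_eq_zero_of_lt (n := n) (k := p + 2) (by omega),
    Nat.choose_eq_zero_of_lt (n := m) (k := q + 2) (by omega)] at h2
  have h4 : (0 : ℤ) < m * n - m - n := by
    zify at hn hm
    nlinarith
  rcases lt_or_ge (p + q + 1) k with hk | hk
  · have := hup (p + q + 1) (by omega) hk
    omega
  · have := hdown (p + q + 2) (by omega)
    omega

theorem not_unimodal_convSeq_iff {m n p q : ℕ} (hn : 1 ≤ n) (hnm : n ≤ m) :
    ¬ Unimodal (convSeq m n p q) ↔ 2 ≤ n ∧ 3 ≤ m ∧ n ≤ p ∧ m ≤ q := by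
  refine ⟨fun h => ?_, fun ⟨h1, h2, h3, h4⟩ => not_unimodal_convSeq h1 h2 h3 h4⟩
  by_contra hc
  refine h ?_
  by_cases hpq : q < m ∨ p < n
  · exact unimodal_convSeq_of_lt hn hnm hpq
  · exact unimodal_convSeq_of_le (by omega) (by omega) (by omega)

/-- With `m + n = j + 5`, `n = u + 2` and `w = N - 11 - 2 * j`, the number of `(p, q)` counted by
`bCount N`. -/
def pairCount (w j u : ℕ) : ℕ := if 2 * u = j + 1 then w / 2 + 1 else w + 1

theorem bCount_eq_sum (N : ℕ) :
    bCount N = ∑ j ∈ Finset.range ((N - 1) / 2 - 4), ∑ u ∈ Finset.range ((j + 1) / 2 + 1),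
      pairCount (N - 11 - 2 * j) j u := by
  set F := (Finset.range ((N - 1) / 2 - 4)).sigma fun j =>
    (Finset.range ((j + 1) / 2 + 1)).sigma fun u =>
      Finset.range (pairCount (N - 11 - 2 * j) j u) with hF
  have hcard : F.card = ∑ j ∈ Finset.range ((N - 1) / 2 - 4),
      ∑ u ∈ Finset.range ((j + 1) / 2 + 1), pairCount (N - 11 - 2 * j) j u := by
    simp [hF, Finset.card_sigma]
  have hmem (j u a : ℕ) : (⟨j, u, a⟩ : Σ _ : ℕ, Σ _ : ℕ, ℕ) ∈ F ↔
      j < (N - 1) / 2 - 4 ∧ u < (j + 1) / 2 + 1 ∧ a < pairCount (N - 11 - 2 * j) j u := by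
    simp [hF]
  rw [← hcard, ← Set.ncard_coe_finset, bCount]
  symm
  refine Set.ncard_congr (fun x _ => (3 + x.1 - x.2.1, 2 + x.2.1, 2 + x.2.1 + x.2.2,
    N - 1 - (5 + x.1) - (2 + x.2.1 + x.2.2))) ?_ ?_ ?_
  · rintro ⟨j, u, a⟩ h
    rw [Finset.mem_coe, hmem, pairCount] at h
    simp only [Set.mem_ofPred_eq]
    rw [not_unimodal_convSeq_iff (by omega) (by omega)]
    split_ifs at h <;> omega
  · rintro ⟨j, u, a⟩ ⟨j', u', a'⟩ h h' he
    rw [Finset.mem_coe, hmem] at h h'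
    simp only [Prod.mk.injEq] at he
    obtain rfl : u = u' := by omega
    obtain rfl : j = j' := by omega
    obtain rfl : a = a' := by omega
    rfl
  · rintro ⟨m, n, p, q⟩ ⟨h1, h2, h3, h4, h5⟩
    dsimp only at h1 h2 h3 h4 h5
    rw [not_unimodal_convSeq_iff h1 h2] at h5
    refine ⟨⟨m + n - 5, n - 2, p - n⟩, ?_, ?_⟩
    · rw [Finset.mem_coe, hmem, pairCount]
      split_ifs <;> omega
    · simp only [Prod.mk.injEq]
      omega

theorem sum_pairCount (w j : ℕ) :
    ∑ u ∈ Finset.range ((j + 1) / 2 + 1), pairCount w j u =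
      (j / 2 + 1) * (w + 1) + j % 2 * (w / 2 + 1) := by
  have h (t : ℕ) (ht : 2 * t ≤ j + 2) :
      ∑ u ∈ Finset.range t, pairCount w j u = t * (w + 1) := by
    have hc : ∀ u ∈ Finset.range t, pairCount w j u = w + 1 := fun u hu =>
      if_neg (by rw [Finset.mem_range] at hu; omega)
    rw [Finset.sum_congr rfl hc]
    simp
  obtain ⟨t, rfl | rfl⟩ := Nat.even_or_odd' j
  · rw [h ((2 * t + 1) / 2 + 1) (by omega), show 2 * t % 2 = 0 by omega,
      show (2 * t + 1) / 2 = 2 * t / 2 by omega]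
    ring
  · rw [Finset.sum_range_succ, h ((2 * t + 1 + 1) / 2) (by omega), pairCount, if_pos (by omega),
      show (2 * t + 1) % 2 = 1 by omega, show (2 * t + 1 + 1) / 2 = (2 * t + 1) / 2 + 1 by omega]
    ring

theorem bCount_even (k : ℕ) :
    (bCount (2 * k + 10) : ℤ) = ∑ j ∈ Finset.range k, ((k : ℤ) - j) * (j + 2) := by
  rw [bCount_eq_sum, show (2 * k + 10 - 1) / 2 - 4 = k by omega]
  rw [Nat.cast_sum]
  refine Finset.sum_congr rfl fun j hj => ?_
  rw [Finset.mem_range] at hj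
  rw [sum_pairCount]
  obtain ⟨d, rfl⟩ := Nat.exists_eq_add_of_lt hj
  rw [show 2 * (j + d + 1) + 10 - 11 - 2 * j = 2 * d + 1 by omega,
    show (2 * d + 1) / 2 = d by omega]
  have : (2 * (j / 2 : ℕ) + (j % 2 : ℕ) : ℤ) = j := by omega
  push_cast at this ⊢
  linear_combination (d + 1 : ℤ) * this

theorem bCount_odd (k : ℕ) :
    (bCount (2 * k + 11) : ℤ) =
      bCount (2 * k + 10) + ∑ j ∈ Finset.range (k + 1), (((j + 1) / 2 + 1 : ℕ) : ℤ) := by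
  have h0 : ∑ j ∈ Finset.range k, ((k : ℤ) - j) * (j + 2) =
      ∑ j ∈ Finset.range (k + 1), ((k : ℤ) - j) * (j + 2) := by
    rw [Finset.sum_range_succ]; simp
  rw [bCount_even, h0, ← Finset.sum_add_distrib, bCount_eq_sum,
    show (2 * k + 11 - 1) / 2 - 4 = k + 1 by omega]
  rw [Nat.cast_sum]
  refine Finset.sum_congr rfl fun j hj => ?_
  rw [Finset.mem_range] at hj
  rw [sum_pairCount]
  obtain ⟨d, rfl⟩ := Nat.exists_eq_add_of_le (Nat.le_of_lt_succ hj)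
  rw [show 2 * (j + d) + 11 - 11 - 2 * j = 2 * d by omega, show 2 * d / 2 = d by omega]
  have h1 : (2 * (j / 2 : ℕ) + (j % 2 : ℕ) : ℤ) = j := by omega
  have h2 : (((j + 1) / 2 + 1 : ℕ) : ℤ) = (j / 2 : ℕ) + (j % 2 : ℕ) + 1 := by omega
  rw [h2]
  push_cast at h1 ⊢
  linear_combination (d : ℤ) * h1

theorem sum_half_succ (k : ℕ) :
    ∑ j ∈ Finset.range (k + 1), ((j + 1) / 2 + 1) = (k + 1) * (k + 5) / 4 := by
  induction k with
  | zero => rfl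
  | succ k ih =>
    rw [Finset.sum_range_succ, ih]
    obtain ⟨t, rfl | rfl⟩ := Nat.even_or_odd' k
    · rw [show (2 * t + 1) * (2 * t + 5) = 4 * (t * t + 3 * t + 1) + 1 by ring,
        show (2 * t + 1 + 1) * (2 * t + 1 + 5) = 4 * (t * t + 4 * t + 3) by ring]
      omega
    · rw [show (2 * t + 1 + 1) * (2 * t + 1 + 5) = 4 * (t * t + 4 * t + 3) by ring,
        show (2 * t + 1 + 1 + 1) * (2 * t + 1 + 1 + 5) = 4 * (t * t + 5 * t + 5) + 1 by ring]
      omega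

theorem sum_add_two (k : ℕ) :
    ∑ j ∈ Finset.range (k + 1), ((j : ℤ) + 2) =
      2 * (((k + 1) * (k + 5) / 4 : ℕ) : ℤ) - (((k + 1) ^ 2 / 4 : ℕ) : ℤ) +
        ((k ^ 2 / 4 : ℕ) : ℤ) := by
  have h : 2 * ∑ j ∈ Finset.range (k + 1), ((j : ℤ) + 2) = (k + 1) * (k + 4) := by
    induction k with
    | zero => simp
    | succ k ih =>
      rw [Finset.sum_range_succ, mul_add, ih]
      push_cast
      ring
  obtain ⟨t, rfl | rfl⟩ := Nat.even_or_odd' k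
  · rw [show (2 * t + 1) * (2 * t + 5) / 4 = t * t + 3 * t + 1 by
        rw [show (2 * t + 1) * (2 * t + 5) = 4 * (t * t + 3 * t + 1) + 1 by ring]; omega,
      show (2 * t + 1) ^ 2 / 4 = t * t + t by
        rw [show (2 * t + 1) ^ 2 = 4 * (t * t + t) + 1 by ring]; omega,
      show (2 * t) ^ 2 / 4 = t * t by rw [show (2 * t) ^ 2 = 4 * (t * t) by ring]; omega]
    push_cast at h ⊢
    linarith
  · rw [show (2 * t + 1 + 1) * (2 * t + 1 + 5) / 4 = t * t + 4 * t + 3 by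
        rw [show (2 * t + 1 + 1) * (2 * t + 1 + 5) = 4 * (t * t + 4 * t + 3) by ring]; omega,
      show (2 * t + 1 + 1) ^ 2 / 4 = t * t + 2 * t + 1 by
        rw [show (2 * t + 1 + 1) ^ 2 = 4 * (t * t + 2 * t + 1) by ring]; omega,
      show (2 * t + 1) ^ 2 / 4 = t * t + t by
        rw [show (2 * t + 1) ^ 2 = 4 * (t * t + t) + 1 by ring]; omega]
    push_cast at h ⊢
    linarith

theorem sum_sub_mul_add_two (k : ℕ) :
    ∑ j ∈ Finset.range k, ((k : ℤ) - j) * (j + 2) =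
      2 * (∑ i ∈ Finset.range (k + 1), ((i * (i + 4) / 4 : ℕ) : ℤ)) - ((k ^ 2 / 4 : ℕ) : ℤ) := by
  induction k with
  | zero => simp
  | succ k ih =>
    have h : ∑ j ∈ Finset.range (k + 1), (((k + 1 : ℕ) : ℤ) - j) * (j + 2) =
        ∑ j ∈ Finset.range k, ((k : ℤ) - j) * (j + 2) +
          ∑ j ∈ Finset.range (k + 1), ((j : ℤ) + 2) := by
      have h0 : ∑ j ∈ Finset.range k, ((k : ℤ) - j) * (j + 2) =
          ∑ j ∈ Finset.range (k + 1), ((k : ℤ) - j) * (j + 2) := by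
        rw [Finset.sum_range_succ]; simp
      rw [h0, ← Finset.sum_add_distrib]
      refine Finset.sum_congr rfl fun j _ => ?_
      push_cast
      ring
    rw [h, ih, Finset.sum_range_succ _ (k + 1), sum_add_two]
    ring

theorem bCount_formula :
    (∀ N, 1 ≤ N → N ≤ 9 → bCount N = 0) ∧
    (∀ k : ℕ,
      (bCount (2 * k + 10) : ℤ) =
        2 * (∑ i ∈ Finset.range (k + 1), ((i * (i + 4) / 4 : ℕ) : ℤ))
          - ((k ^ 2 / 4 : ℕ) : ℤ) ∧
      (bCount (2 * k + 11) : ℤ) =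
        2 * (∑ i ∈ Finset.range (k + 1), ((i * (i + 4) / 4 : ℕ) : ℤ))
          + (((k + 1) * (k + 5) / 4 : ℕ) : ℤ) - ((k ^ 2 / 4 : ℕ) : ℤ)) := by
  refine ⟨fun N _ hN => ?_, fun k => ⟨?_, ?_⟩⟩
  · rw [bCount_eq_sum, show (N - 1) / 2 - 4 = 0 by omega, Finset.sum_range_zero]
  · rw [bCount_even, sum_sub_mul_add_two]
  · rw [bCount_odd, bCount_even, sum_sub_mul_add_two, ← sum_half_succ, Nat.cast_sum]
    ring
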